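/- Let G be the series composition of multigraphs G1 and G2 at a vertex x, let a, s ∈ V1 \ {x} be distinct, let b ∈ V2 \ {x}, and let r_a, r_s, r_b ∈ ℤ with r_a + r_s + r_b = 0. Then mincost(G, [a ↦ r_a, s ↦ r_s, b ↦ r_b]) = mincost(G1, [a ↦ r_a, s ↦ r_s, x ↦ −r_a − r_s]) + mincost(G2, [x ↦ r_a + r_s, b ↦ r_b]), where the addition is in ℕ∞. -/

import Mathlib

open scoped BigOperators

/-- An undirected multigraph on vertex type `V` with edge type `E`:
each edge has a reference orientation `src e → tgt e`, a cost `c e` and a capacity `u e`. -/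
structure Multigraph (V E : Type) where
  src : E → V
  tgt : E → V
  c : E → ℕ
  u : E → ℕ

variable {V E : Type}

/-- The residue of a flow assignment `f : E → ℤ` at a vertex `v`:
inflow (w.r.t. the reference orientation) minus outflow. -/
def Multigraph.residue [Fintype E] [DecidableEq V] (G : Multigraph V E)
    (f : E → ℤ) (v : V) : ℤ :=
  (∑ e : E, if G.tgt e = v then f e else 0) - (∑ e : E, if G.src e = v then f e else 0)

/-- `f` is an `r`-circulation supported on `F`: it vanishes outside `F`,
respects capacities, and has residue `r v` at every vertex `v`. -/
def Multigraph.IsCirculation [Fintype E] [DecidableEq V] (G : Multigraph V E)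
    (r : V → ℤ) (F : Finset E) (f : E → ℤ) : Prop :=
  (∀ e, e ∉ F → f e = 0) ∧ (∀ e, |f e| ≤ (G.u e : ℤ)) ∧ (∀ v, G.residue f v = r v)

/-- The minimum cost (in `ℕ∞`) of a subset `F` of the allowed edge set `E'`
admitting an `r`-circulation supported on `F`.  Taking `E' = Finset.univ`
gives `mincost(G, r)`; taking `E' = E₁` for a sub-multigraph `(V₁, E₁)` all of
whose edges have both endpoints in `V₁` gives `mincost(G₁, r)` whenever `r`
vanishes outside `V₁`. -/
noncomputable def Multigraph.mincostOn [Fintype E] [DecidableEq V] (G : Multigraph V E)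
    (E' : Finset E) (r : V → ℤ) : ℕ∞ :=
  ⨅ (F : Finset E) (_ : F ⊆ E' ∧ ∃ f : E → ℤ, G.IsCirculation r F f),
    ((∑ e ∈ F, G.c e : ℕ) : ℕ∞)

namespace Multigraph

theorem residue_add [Fintype E] [DecidableEq V] (G : Multigraph V E) (f g : E → ℤ) (v : V) :
    G.residue (f + g) v = G.residue f v + G.residue g v := by
  simp only [residue, ← Finset.sum_filter, Pi.add_apply, Finset.sum_add_distrib]
  ring

theorem sum_residue [Fintype V] [Fintype E] [DecidableEq V] (G : Multigraph V E) (f : E → ℤ) :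
    ∑ v, G.residue f v = 0 := by
  simp only [residue, Finset.sum_sub_distrib]
  rw [Finset.sum_comm, Finset.sum_comm (f := fun v e => if G.src e = v then f e else 0)]
  simp

theorem residue_eq_zero_of_notMem [Fintype E] [DecidableEq V] (G : Multigraph V E)
    {W : Finset V} {f : E → ℤ} (hf : ∀ e, f e ≠ 0 → G.src e ∈ W ∧ G.tgt e ∈ W)
    {v : V} (hv : v ∉ W) : G.residue f v = 0 := by
  unfold residue
  rw [Finset.sum_eq_zero, Finset.sum_eq_zero, sub_zero] <;>
  · intro e _
    split_ifs with h
    · by_contra h0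
      exact hv (h ▸ by simp [hf e h0])
    · rfl

theorem mincostOn_le [Fintype E] [DecidableEq V] (G : Multigraph V E) {E' F : Finset E}
    {r : V → ℤ} {f : E → ℤ} (hF : F ⊆ E') (hf : G.IsCirculation r F f) :
    G.mincostOn E' r ≤ ((∑ e ∈ F, G.c e : ℕ) : ℕ∞) :=
  iInf₂_le F ⟨hF, f, hf⟩

/-- A finite minimum cost is attained. -/
theorem exists_mincostOn_eq [Fintype E] [DecidableEq V] (G : Multigraph V E) {E' : Finset E}
    {r : V → ℤ} (h : G.mincostOn E' r ≠ ⊤) :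
    ∃ F ⊆ E', ∃ f, G.IsCirculation r F f ∧
      G.mincostOn E' r = ((∑ e ∈ F, G.c e : ℕ) : ℕ∞) := by
  unfold mincostOn at h ⊢
  rw [iInf_subtype'] at h ⊢
  rcases isEmpty_or_nonempty {F : Finset E // F ⊆ E' ∧ ∃ f, G.IsCirculation r F f} with hE | hE
  · exact absurd (iInf_of_empty _) h
  · obtain ⟨⟨F, hF, f, hf⟩, hFc⟩ := ciInf_mem
      fun F : {F : Finset E // F ⊆ E' ∧ ∃ f, G.IsCirculation r F f} =>
        ((∑ e ∈ F.1, G.c e : ℕ) : ℕ∞)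
    exact ⟨F, hF, f, hf, hFc.symm⟩

/-- In a series composition, minimum costs add up whenever the prescribed residues split into
a part on each side, balanced on one (hence on both) of them. -/
theorem mincostOn_series [Fintype V] [Fintype E] [DecidableEq V] [DecidableEq E]
    (G : Multigraph V E) {V1 V2 : Finset V} {E1 E2 : Finset E} {x : V}
    (hE : E1 ∪ E2 = Finset.univ) (hEdisj : Disjoint E1 E2)
    (hG1 : ∀ e ∈ E1, G.src e ∈ V1 ∧ G.tgt e ∈ V1)
    (hG2 : ∀ e ∈ E2, G.src e ∈ V2 ∧ G.tgt e ∈ V2) (hVx : V1 ∩ V2 = {x})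
    {r r1 r2 : V → ℤ} (hr : ∀ v, r v = r1 v + r2 v) (hr1 : ∀ v ∉ V1, r1 v = 0)
    (hr2 : ∀ v ∉ V2, r2 v = 0) (hr1_sum : ∑ v, r1 v = 0) :
    G.mincostOn Finset.univ r = G.mincostOn E1 r1 + G.mincostOn E2 r2 := by
  have hdisj : ∀ {e}, e ∈ E1 → e ∉ E2 := fun h1 h2 => Finset.disjoint_left.mp hEdisj h1 h2
  have hcov : ∀ e, e ∈ E1 ∨ e ∈ E2 := fun e => by
    rw [← Finset.mem_union, hE]; exact Finset.mem_univ e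
  apply le_antisymm
  · by_cases h1 : G.mincostOn E1 r1 = ⊤
    · simp [h1]
    by_cases h2 : G.mincostOn E2 r2 = ⊤
    · simp [h2]
    obtain ⟨F1, hF1, f1, ⟨hs1, hc1, hres1⟩, heq1⟩ := G.exists_mincostOn_eq h1
    obtain ⟨F2, hF2, f2, ⟨hs2, hc2, hres2⟩, heq2⟩ := G.exists_mincostOn_eq h2
    rw [heq1, heq2, ← Nat.cast_add,
      ← Finset.sum_union (Finset.disjoint_of_subset_left hF1
        (Finset.disjoint_of_subset_right hF2 hEdisj))]
    refine G.mincostOn_le (Finset.subset_univ _) (f := f1 + f2) ⟨?_, ?_, ?_⟩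
    · intro e he
      rw [Finset.mem_union, not_or] at he
      simp [hs1 e he.1, hs2 e he.2]
    · intro e
      rcases hcov e with h | h
      · simpa [hs2 e fun h' => hdisj h (hF2 h')] using hc1 e
      · simpa [hs1 e fun h' => hdisj (hF1 h') h] using hc2 e
    · intro v
      rw [residue_add, hres1, hres2, hr]
  · refine le_iInf₂ ?_
    rintro F ⟨-, f, hs, hc, hres⟩
    let f1 : E → ℤ := fun e => if e ∈ E1 then f e else 0
    let f2 : E → ℤ := fun e => if e ∈ E2 then f e else 0
    have hf : f1 + f2 = f := by
      funext e
      rcases hcov e with h | h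
      · simp [f1, f2, h, hdisj h]
      · have h1 : e ∉ E1 := fun h' => hdisj h' h
        simp [f1, f2, h, h1]
    have hout1 : ∀ v ∉ V1, G.residue f1 v = 0 := fun v =>
      G.residue_eq_zero_of_notMem fun e he => hG1 e (by by_contra h; simp [f1, h] at he)
    have hout2 : ∀ v ∉ V2, G.residue f2 v = 0 := fun v =>
      G.residue_eq_zero_of_notMem fun e he => hG2 e (by by_contra h; simp [f2, h] at he)
    have hadd : ∀ v, G.residue f1 v + G.residue f2 v = r1 v + r2 v := fun v => by
      rw [← residue_add, hf, hres, hr]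
    have hne : ∀ v ≠ x, G.residue f1 v = r1 v := by
      intro v hv
      by_cases h1 : v ∈ V1
      · have h2 : v ∉ V2 := fun h2 =>
          hv (Finset.mem_singleton.mp (hVx ▸ Finset.mem_inter.mpr ⟨h1, h2⟩))
        have := hadd v
        rwa [hout2 v h2, hr2 v h2, add_zero, add_zero] at this
      · rw [hout1 v h1, hr1 v h1]
    have hres1 : ∀ v, G.residue f1 v = r1 v := by
      intro v
      rcases ne_or_eq v x with hv | rfl
      · exact hne v hv
      · have h := (G.sum_residue f1).trans hr1_sum.symm
        rw [← Finset.add_sum_erase _ _ (Finset.mem_univ v),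
          ← Finset.add_sum_erase _ r1 (Finset.mem_univ v),
          Finset.sum_congr rfl fun w hw => hne w (Finset.ne_of_mem_erase hw)] at h
        exact add_right_cancel h
    have hres2 : ∀ v, G.residue f2 v = r2 v := fun v => by
      have := hadd v
      rwa [hres1, add_right_inj] at this
    have hcost : ∑ e ∈ F, G.c e = ∑ e ∈ F ∩ E1, G.c e + ∑ e ∈ F ∩ E2, G.c e := by
      rw [← Finset.sum_union (Finset.disjoint_of_subset_left Finset.inter_subset_right
        (Finset.disjoint_of_subset_right Finset.inter_subset_right hEdisj)),
        ← Finset.inter_union_distrib_left, hE, Finset.inter_univ]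
    rw [hcost, Nat.cast_add]
    refine add_le_add
      (G.mincostOn_le Finset.inter_subset_right (f := f1) ⟨?_, ?_, hres1⟩)
      (G.mincostOn_le Finset.inter_subset_right (f := f2) ⟨?_, ?_, hres2⟩)
    all_goals intro e
    · simp only [Finset.mem_inter, not_and', f1]
      intro h
      split_ifs with h1
      exacts [hs e (h h1), rfl]
    · by_cases h1 : e ∈ E1 <;> simp [f1, h1, hc e]
    · simp only [Finset.mem_inter, not_and', f2]
      intro h
      split_ifs with h2
      exacts [hs e (h h2), rfl]
    · by_cases h2 : e ∈ E2 <;> simp [f2, h2, hc e]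

end Multigraph

/-- Case 2.2: series composition not splitting at `s`, 3-tuple of residues. -/
theorem series_three_tuple_no_split {V E : Type}
    [Fintype V] [Fintype E] [DecidableEq V] [DecidableEq E]
    (G : Multigraph V E) (V1 V2 : Finset V) (E1 E2 : Finset E)
    (hE : E1 ∪ E2 = Finset.univ) (hEdisj : Disjoint E1 E2)
    (hV : V1 ∪ V2 = Finset.univ)
    (hG1 : ∀ e ∈ E1, G.src e ∈ V1 ∧ G.tgt e ∈ V1)
    (hG2 : ∀ e ∈ E2, G.src e ∈ V2 ∧ G.tgt e ∈ V2)
    (x a s b : V) (hVx : V1 ∩ V2 = {x})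
    (ha : a ∈ V1) (hax : a ≠ x) (hs : s ∈ V1) (hsx : s ≠ x) (has : a ≠ s)
    (hb : b ∈ V2) (hbx : b ≠ x)
    (ra rs rb : ℤ) (hsum : ra + rs + rb = 0) :
    G.mincostOn Finset.univ
        (fun v => if v = a then ra else if v = s then rs else if v = b then rb else 0) =
      G.mincostOn E1
        (fun v => if v = a then ra else if v = s then rs else if v = x then -ra - rs else 0) +
      G.mincostOn E2 (fun v => if v = x then ra + rs else if v = b then rb else 0) := by
  have hx : x ∈ V1 ∧ x ∈ V2 := by
    rw [← Finset.mem_inter, hVx]; exact Finset.mem_singleton_self x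
  have hb1 : b ∉ V1 := fun h =>
    hbx (Finset.mem_singleton.mp (hVx ▸ Finset.mem_inter.mpr ⟨h, hb⟩))
  have hab : a ≠ b := fun h => hb1 (h ▸ ha)
  have hsb : s ≠ b := fun h => hb1 (h ▸ hs)
  refine G.mincostOn_series hE hEdisj hG1 hG2 hVx ?_ ?_ ?_ ?_
  · intro v
    grind
  · intro v hv
    grind
  · intro v hv
    grind
  · have h : ∀ v, (if v = a then ra else if v = s then rs else if v = x then -ra - rs else 0) =
        (if v = a then ra else 0) + (if v = s then rs else 0) +
          (if v = x then -ra - rs else 0) := by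
      intro v
      grind
    simp only [h, Finset.sum_add_distrib, Finset.sum_ite_eq', Finset.mem_univ, if_true]
    ring
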